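/- Let S be a genuine spectral band, μ ∈ S°, δ = δ(μ) the unique solution of Λ(δ) = μ, and Φ = Φ(·,δ). Let Z_α^+ and Z_α^− be the operators with kernels χ_{(α+1,∞)}(x)χ_{(−α,α)}(y)/(2π(x−y)) and χ_{(−∞,−α−1)}(x)χ_{(−α,α)}(y)/(2π(x−y)) respectively, and let Y_α^± denote either Z_α^± or (Z_α^±)*. Then Y_α^± |Φ|² (Y_α^±)* ∼ (2π)^{−1} Y_α^± (Y_α^±)* and Y_α^± Φ² (Y_α^±)* ∼ 0, where Φ², |Φ|² act as multiplication operators. -/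

import Mathlib

open MeasureTheory Filter Set Complex Real
open scoped ENNReal Topology

noncomputable section

/-- The Hilbert space `L²(ℝ)`. -/
abbrev L2R : Type := MeasureTheory.Lp ℂ 2 (MeasureTheory.volume : MeasureTheory.Measure ℝ)

/-- The `n`-th approximation number (= singular value) of a bounded operator. -/
noncomputable def sNum {E : Type*} [NormedAddCommGroup E] [InnerProductSpace ℂ E]
    (A : E →L[ℂ] E) (n : ℕ) : ℝ :=
  sInf {r : ℝ | ∃ F : E →L[ℂ] E,
    Module.rank ℂ ↥(LinearMap.range (F : E →ₗ[ℂ] E)) ≤ (n : Cardinal) ∧ r = ‖A - F‖}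

/-- The trace norm (Schatten `𝔖₁`-norm) of an operator, with value in `ℝ≥0∞`. -/
noncomputable def traceNorm {E : Type*} [NormedAddCommGroup E] [InnerProductSpace ℂ E]
    (A : E →L[ℂ] E) : ℝ≥0∞ :=
  ∑' n : ℕ, ENNReal.ofReal (sNum A n)

/-- A (possibly unbounded-kernel) operator with integral kernel `K`. -/
def HasKernel (A : L2R →L[ℂ] L2R) (K : ℝ → ℝ → ℂ) : Prop :=
  ∀ f : L2R, (A f : ℝ → ℂ) =ᵐ[MeasureTheory.volume] fun x => ∫ y, K x y * (f : ℝ → ℂ) y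

/-- `M` is the operator of multiplication by the bounded function `w`. -/
def IsMul (M : L2R →L[ℂ] L2R) (w : ℝ → ℂ) : Prop :=
  ∀ f : L2R, (M f : ℝ → ℂ) =ᵐ[MeasureTheory.volume] fun x => w x * (f : ℝ → ℂ) x

/-- `APmean f c` : `f` has almost-periodic mean `c`. -/
def APmean (f : ℝ → ℂ) (c : ℂ) : Prop :=
  Filter.Tendsto (fun T : ℝ => (2 * T)⁻¹ • ∫ t in (-T)..T, f t) Filter.atTop (nhds c)

/-- The kernel of `Z_α^+`. -/
def ZplusKer (α : ℝ) (x y : ℝ) : ℂ :=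
  Set.indicator (Set.Ioi (α + 1)) (fun _ => (1:ℂ)) x *
    Set.indicator (Set.Ioo (-α) α) (fun _ => (1:ℂ)) y /
      (2 * Real.pi * ((x : ℂ) - (y : ℂ)))

/-- The kernel of `Z_α^-`. -/
def ZminusKer (α : ℝ) (x y : ℝ) : ℂ :=
  Set.indicator (Set.Iio (-α - 1)) (fun _ => (1:ℂ)) x *
    Set.indicator (Set.Ioo (-α) α) (fun _ => (1:ℂ)) y /
      (2 * Real.pi * ((x : ℂ) - (y : ℂ)))

section TraceNorm

variable {H : Type*} [NormedAddCommGroup H] [InnerProductSpace ℂ H]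

lemma sNum_le_norm_sub (T F : H →L[ℂ] H) {n : ℕ}
    (hF : LinearMap.rank (F : H →ₗ[ℂ] H) ≤ (n : Cardinal)) : sNum T n ≤ ‖T - F‖ :=
  csInf_le ⟨0, by rintro r ⟨F, -, rfl⟩; exact norm_nonneg _⟩ ⟨F, hF, rfl⟩

lemma sNum_antitone (T : H →L[ℂ] H) : Antitone (sNum T) := by
  intro m n hmn
  refine csInf_le_csInf ⟨0, by rintro r ⟨F, -, rfl⟩; exact norm_nonneg _⟩ ⟨‖T - 0‖, 0, ?_, rfl⟩ ?_
  · have : LinearMap.range ((0 : H →L[ℂ] H) : H →ₗ[ℂ] H) = ⊥ := LinearMap.range_zero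
    rw [this]
    simp
  · rintro r ⟨F, hF, rfl⟩
    exact ⟨F, hF.trans (by exact_mod_cast hmn), rfl⟩

/-- Compressing to the orthogonal complement of the span of a finite set `S` changes an operator
by an operator of rank at most `2 * S.card`. -/
lemma sNum_two_mul_card_le (T : H →L[ℂ] H) (S : Finset H) {r : ℝ} (hr : 0 ≤ r)
    (h : ∀ u ∈ (Submodule.span ℂ (S : Set H))ᗮ, ∀ v ∈ (Submodule.span ℂ (S : Set H))ᗮ,
      ‖u‖ = 1 → ‖v‖ = 1 → ‖inner ℂ v (T u)‖ ≤ r) :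
    sNum T (2 * S.card) ≤ r := by
  set U := Submodule.span ℂ (S : Set H) with hU
  have : FiniteDimensional ℂ U := FiniteDimensional.span_finset ℂ S
  set P := U.starProjection
  set P' := Uᗮ.starProjection
  have hscale : ∀ u ∈ Uᗮ, ∀ v ∈ Uᗮ, ‖inner ℂ v (T u)‖ ≤ r * ‖u‖ * ‖v‖ := by
    intro u hu v hv
    rcases eq_or_ne u 0 with rfl | hu0
    · simp
    rcases eq_or_ne v 0 with rfl | hv0
    · simp
    have := h (((‖u‖⁻¹ : ℝ) : ℂ) • u) (Uᗮ.smul_mem _ hu) (((‖v‖⁻¹ : ℝ) : ℂ) • v)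
      (Uᗮ.smul_mem _ hv) (by simp [norm_smul, hu0]) (by simp [norm_smul, hv0])
    rw [map_smul, inner_smul_left, inner_smul_right] at this
    simp only [norm_mul, RCLike.norm_conj, Complex.norm_real, norm_inv, norm_norm] at this
    have hu' := norm_pos_iff.2 hu0
    have hv' := norm_pos_iff.2 hv0
    calc ‖inner ℂ v (T u)‖ = (‖v‖⁻¹ * (‖u‖⁻¹ * ‖inner ℂ v (T u)‖)) * ‖u‖ * ‖v‖ := by
          field_simp
      _ ≤ r * ‖u‖ * ‖v‖ := by gcongr
  have hrankU : Module.rank ℂ U ≤ (S.card : Cardinal) := by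
    simpa [hU] using rank_span_finset_le (R := ℂ) S
  have hP : LinearMap.rank (P : H →ₗ[ℂ] H) ≤ (S.card : Cardinal) := by
    refine (Submodule.rank_mono ?_).trans hrankU
    rintro _ ⟨x, rfl⟩
    exact U.starProjection_apply_mem x
  let F : H →L[ℂ] H := T ∘L P + P ∘L (T ∘L P')
  have hF : LinearMap.rank (F : H →ₗ[ℂ] H) ≤ ((2 * S.card : ℕ) : Cardinal) := by
    have h1 : LinearMap.rank ((T : H →ₗ[ℂ] H) ∘ₗ (P : H →ₗ[ℂ] H)) ≤ (S.card : Cardinal) :=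
      (LinearMap.rank_comp_le_right _ _).trans hP
    have h2 : LinearMap.rank ((P : H →ₗ[ℂ] H) ∘ₗ ((T : H →ₗ[ℂ] H) ∘ₗ (P' : H →ₗ[ℂ] H)))
        ≤ (S.card : Cardinal) := (LinearMap.rank_comp_le_left _ _).trans hP
    refine (LinearMap.rank_add_le _ _).trans ((add_le_add h1 h2).trans_eq ?_)
    push_cast
    ring
  refine (sNum_le_norm_sub T F hF).trans (ContinuousLinearMap.opNorm_le_bound _ hr fun x => ?_)
  have hx : ∀ y : H, y = P y + P' y := fun y => by
    simp [P, P', Submodule.starProjection_orthogonal_val]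
  have hTF : (T - F) x = P' (T (P' x)) := by
    have h1 : T x = T (P x) + T (P' x) := by rw [← map_add, ← hx x]
    have h2 := hx (T (P' x))
    simp only [F, sub_apply, add_apply, ContinuousLinearMap.comp_apply]
    rw [h1]
    nth_rewrite 1 [h2]
    abel
  rw [hTF]
  set y := P' x
  set z := P' (T y)
  have hz : ‖z‖ * ‖z‖ ≤ r * ‖y‖ * ‖z‖ := by
    have h1 : inner ℂ z z = inner ℂ z (T y) := by
      have : P' z = z := Submodule.starProjection_eq_self_iff.2
        (Submodule.starProjection_apply_mem _ _)
      have h := Submodule.inner_starProjection_left_eq_right Uᗮ z (T y)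
      rw [show Uᗮ.starProjection z = z from this] at h
      exact h.symm
    have h2 := hscale y (Submodule.starProjection_apply_mem _ _) z
      (Submodule.starProjection_apply_mem _ _)
    rw [← h1] at h2
    rwa [inner_self_eq_norm_sq_to_K, norm_pow, RCLike.norm_ofReal, abs_norm, sq] at h2
  have hy : ‖y‖ ≤ ‖x‖ := Uᗮ.norm_starProjection_apply_le x
  rcases (norm_nonneg z).eq_or_lt with h0 | h0
  · rw [← h0]; positivity
  · exact (le_of_mul_le_mul_right hz h0).trans (by gcongr)

lemma exists_finset_sum_sNum_le (T : H →L[ℂ] H) (q : H → ℝ≥0∞)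
    (hT : ∀ u v : H, ‖u‖ = 1 → ‖v‖ = 1 → ‖inner ℂ v (T u)‖ₑ ≤ q u + q v) (N : ℕ) :
    ∃ S : Finset H, Orthonormal ℂ (fun u : S => (u : H)) ∧ S.card ≤ N ∧
      ∑ n ∈ Finset.range N, ENNReal.ofReal (sNum T (2 * n)) ≤ 4 * ∑ u ∈ S, q u := by
  classical
  induction N with
  | zero => exact ⟨∅, ⟨by simp, fun i => (Finset.notMem_empty _ i.2).elim⟩, by simp, by simp⟩
  | succ N ih =>
    obtain ⟨S, hS, hcard, hsum⟩ := ih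
    rw [Finset.sum_range_succ]
    rcases le_or_gt (sNum T (2 * N)) 0 with h0 | h0
    · exact ⟨S, hS, by omega, by simpa [ENNReal.ofReal_of_nonpos h0] using hsum⟩
    obtain ⟨w, hwU, hw1, hwq⟩ : ∃ w ∈ (Submodule.span ℂ (S : Set H))ᗮ, ‖w‖ = 1 ∧
        ENNReal.ofReal (sNum T (2 * N)) ≤ 4 * q w := by
      by_contra! hcon
      have hlt : ∀ w ∈ (Submodule.span ℂ (S : Set H))ᗮ, ‖w‖ = 1 →
          q w ≤ ENNReal.ofReal (sNum T (2 * N) / 4) := by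
        intro w hw hw1
        have := (hcon w hw hw1).le
        rw [ENNReal.ofReal_div_of_pos (by norm_num)]
        rw [ENNReal.le_div_iff_mul_le (by simp) (by simp), mul_comm]
        simpa using this
      have := sNum_two_mul_card_le T S (r := sNum T (2 * N) / 2) (by positivity)
        (fun u hu v hv hu1 hv1 => by
          have h1 := (hT u v hu1 hv1).trans (add_le_add (hlt u hu hu1) (hlt v hv hv1))
          rw [← ENNReal.ofReal_add (by positivity) (by positivity), ← ofReal_norm,
            ENNReal.ofReal_le_ofReal_iff (by positivity)] at h1
          linarith)
      have h2 := sNum_antitone T (show 2 * S.card ≤ 2 * N by omega)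
      linarith
    have hwS : ∀ u ∈ S, inner ℂ u w = 0 := fun u hu =>
      (Submodule.mem_orthogonal _ _).1 hwU u (Submodule.subset_span hu)
    have hw : w ∉ S := fun hw => by
      have := hwS w hw
      rw [inner_self_eq_zero] at this
      simp [this] at hw1
    refine ⟨insert w S, ?_, by rw [Finset.card_insert_of_notMem hw]; omega, ?_⟩
    · refine (orthonormal_subtype_iff_ite (s := ((insert w S : Finset H) : Set H))).2 ?_
      have hS' := (orthonormal_subtype_iff_ite (s := (S : Set H))).1 hS
      intro v hv v' hv'
      simp only [Finset.coe_insert, Set.mem_insert_iff, Finset.mem_coe] at hv hv'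
      rcases hv with rfl | hv <;> rcases hv' with rfl | hv'
      · simp [inner_self_eq_norm_sq_to_K, hw1]
      · rw [if_neg (by rintro rfl; exact hw hv'), inner_eq_zero_symm]
        exact hwS _ hv'
      · rw [if_neg (by rintro rfl; exact hw hv)]
        exact hwS _ hv
      · exact hS' v hv v' hv'
    · rw [Finset.sum_insert hw, mul_add, add_comm]
      exact add_le_add hwq hsum

/-- A trace-norm bound for an operator whose sesquilinear form is dominated by a functional `q`
with bounded trace. -/
theorem traceNorm_le_of_enorm_inner_le (T : H →L[ℂ] H) (q : H → ℝ≥0∞) (Q : ℝ≥0∞)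
    (hT : ∀ u v : H, ‖u‖ = 1 → ‖v‖ = 1 → ‖inner ℂ v (T u)‖ₑ ≤ q u + q v)
    (hq : ∀ S : Finset H, Orthonormal ℂ (fun u : S => (u : H)) → ∑ u ∈ S, q u ≤ Q) :
    traceNorm T ≤ 8 * Q := by
  have hdouble : ∀ N : ℕ, ∑ n ∈ Finset.range (2 * N), ENNReal.ofReal (sNum T n) ≤
      2 * ∑ n ∈ Finset.range N, ENNReal.ofReal (sNum T (2 * n)) := by
    intro N
    induction N with
    | zero => simp
    | succ N ih =>
      rw [show 2 * (N + 1) = 2 * N + 1 + 1 by ring, Finset.sum_range_succ, Finset.sum_range_succ,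
        Finset.sum_range_succ, mul_add, add_assoc, two_mul (ENNReal.ofReal _)]
      gcongr
      exact sNum_antitone T (by omega)
  refine ENNReal.tsum_le_of_sum_range_le fun N => ?_
  obtain ⟨S, hS, -, hsum⟩ := exists_finset_sum_sNum_le T q hT N
  calc ∑ n ∈ Finset.range N, ENNReal.ofReal (sNum T n)
      ≤ ∑ n ∈ Finset.range (2 * N), ENNReal.ofReal (sNum T n) :=
        Finset.sum_le_sum_of_subset (Finset.range_mono (by omega))
    _ ≤ 2 * (4 * ∑ u ∈ S, q u) := (hdouble N).trans (by gcongr)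
    _ ≤ 2 * (4 * Q) := by gcongr; exact hq S hS
    _ = 8 * Q := by rw [← mul_assoc]; norm_num

end TraceNorm

section Cauchy

/-- The truncated Cauchy kernel `χ_X(x) (x - t)⁻ⁿ`. -/
def cauchyKer (X : Set ℝ) (n : ℕ) (t x : ℝ) : ℂ :=
  X.indicator (fun x : ℝ => (((x : ℂ) - t)⁻¹) ^ n) x

/-- The integral of `u` against the truncated Cauchy kernel. -/
def cauchyTr (X : Set ℝ) (n : ℕ) (u : ℝ → ℂ) (t : ℝ) : ℂ :=
  ∫ x, cauchyKer X n t x * u x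

lemma norm_cauchyKer_of_mem {X : Set ℝ} {x : ℝ} (hx : x ∈ X) (n : ℕ) (t : ℝ) :
    ‖cauchyKer X n t x‖ = (|x - t|⁻¹) ^ n := by
  rw [cauchyKer, Set.indicator_of_mem hx, norm_pow, norm_inv, ← Complex.ofReal_sub,
    Complex.norm_real, Real.norm_eq_abs]

lemma measurable_cauchyKer {X : Set ℝ} (hX : MeasurableSet X) (n : ℕ) :
    Measurable fun z : ℝ × ℝ => cauchyKer X n z.1 z.2 := by
  have : (fun z : ℝ × ℝ => cauchyKer X n z.1 z.2) =
      (Prod.snd ⁻¹' X).indicator (fun z : ℝ × ℝ => (((z.2 : ℂ) - z.1)⁻¹) ^ n) := by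
    ext z
    by_cases h : z.2 ∈ X <;> simp [cauchyKer, h]
  rw [this]
  exact Measurable.indicator (by fun_prop) (measurable_snd hX)

lemma lintegral_Ioi_inv_sq {d : ℝ} (hd : 0 < d) :
    ∫⁻ x in Ioi d, ENNReal.ofReal ((x⁻¹) ^ 2) = ENNReal.ofReal d⁻¹ := by
  have h : ∀ x : ℝ, x ∈ Ioi d → (x⁻¹) ^ 2 = x ^ (-2 : ℝ) := fun x hx => by
    have hx0 : 0 < x := hd.trans hx
    rw [Real.rpow_neg hx0.le, inv_pow]
    norm_cast
  rw [setLIntegral_congr_fun measurableSet_Ioi (fun x hx => by rw [h x hx]),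
    ← ofReal_integral_eq_lintegral_ofReal (integrableOn_Ioi_rpow_of_lt (by norm_num) hd),
    integral_Ioi_rpow_of_lt (by norm_num) hd]
  · congr 1
    norm_num
    exact Real.rpow_neg_one d
  · filter_upwards [ae_restrict_mem measurableSet_Ioi] with x hx
    exact Real.rpow_nonneg (hd.trans hx).le _

lemma lintegral_inv_sq_le {X : Set ℝ} {d t : ℝ} (hd : 0 < d) (hX : ∀ x ∈ X, d ≤ |x - t|) :
    ∫⁻ x in X, ENNReal.ofReal ((|x - t|⁻¹) ^ 2) ≤ ENNReal.ofReal (2 * d⁻¹) := by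
  have hsub : X ⊆ (fun x => x - t) ⁻¹' (Ici d) ∪ (fun x => t - x) ⁻¹' (Ici d) := by
    intro x hx
    rcases le_abs'.1 (hX x hx) with h | h
    · right; show d ≤ t - x; linarith
    · left; exact h
  have key : ∫⁻ x in Ici d, ENNReal.ofReal ((|x|⁻¹) ^ 2) = ENNReal.ofReal d⁻¹ := by
    rw [← lintegral_Ioi_inv_sq hd, setLIntegral_congr Ioi_ae_eq_Ici.symm]
    simp
  calc _ ≤ ∫⁻ x in (fun x => x - t) ⁻¹' (Ici d) ∪ (fun x => t - x) ⁻¹' (Ici d),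
          ENNReal.ofReal ((|x - t|⁻¹) ^ 2) := lintegral_mono_set hsub
    _ ≤ (∫⁻ x in (fun x => x - t) ⁻¹' (Ici d), ENNReal.ofReal ((|x - t|⁻¹) ^ 2)) +
        ∫⁻ x in (fun x => t - x) ⁻¹' (Ici d), ENNReal.ofReal ((|x - t|⁻¹) ^ 2) :=
        lintegral_union_le _ _ _
    _ = ENNReal.ofReal d⁻¹ + ENNReal.ofReal d⁻¹ := by
        congr 1
        · rw [← key, ← lintegral_indicator (measurableSet_Ici.preimage (by fun_prop)),
            ← lintegral_indicator measurableSet_Ici]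
          exact lintegral_sub_right_eq_self
            ((Ici d).indicator fun x => ENNReal.ofReal ((|x|⁻¹) ^ 2)) t
        · simp only [abs_sub_comm _ t]
          rw [← key, ← lintegral_indicator (measurableSet_Ici.preimage (by fun_prop)),
            ← lintegral_indicator measurableSet_Ici]
          exact lintegral_sub_left_eq_self
            ((Ici d).indicator fun x => ENNReal.ofReal ((|x|⁻¹) ^ 2)) t
    _ = ENNReal.ofReal (2 * d⁻¹) := by
        rw [← ENNReal.ofReal_add (by positivity) (by positivity), two_mul]

lemma lintegral_enorm_cauchyKer_sq_le {X : Set ℝ} (hXm : MeasurableSet X) {d t : ℝ} (hd : 0 < d)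
    (hX : ∀ x ∈ X, d ≤ |x - t|) (n : ℕ) :
    ∫⁻ x, ‖cauchyKer X (n + 1) t x‖ₑ ^ 2 ≤ ENNReal.ofReal (2 * (d⁻¹) ^ (2 * n + 1)) := by
  have h1 : ∀ x, ‖cauchyKer X (n + 1) t x‖ₑ ^ 2 ≤
      X.indicator (fun x => ENNReal.ofReal ((d⁻¹) ^ (2 * n)) *
        ENNReal.ofReal ((|x - t|⁻¹) ^ 2)) x := by
    intro x
    by_cases hx : x ∈ X
    · rw [Set.indicator_of_mem hx, ← ofReal_norm, norm_cauchyKer_of_mem hx,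
        ← ENNReal.ofReal_pow (by positivity), ← ENNReal.ofReal_mul (by positivity)]
      refine ENNReal.ofReal_le_ofReal ?_
      have : |x - t|⁻¹ ≤ d⁻¹ := inv_anti₀ hd (hX x hx)
      calc ((|x - t|⁻¹) ^ (n + 1)) ^ 2 = (|x - t|⁻¹) ^ (2 * n) * (|x - t|⁻¹) ^ 2 := by ring
        _ ≤ _ := by gcongr
    · simp [cauchyKer, hx]
  refine (lintegral_mono h1).trans ?_
  rw [lintegral_indicator hXm, lintegral_const_mul _ (by fun_prop)]
  refine (mul_le_mul_right (lintegral_inv_sq_le hd hX) _).trans_eq ?_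
  rw [← ENNReal.ofReal_mul (by positivity)]
  congr 1
  ring

lemma memLp_cauchyKer {X : Set ℝ} (hXm : MeasurableSet X) {d t : ℝ} (hd : 0 < d)
    (hX : ∀ x ∈ X, d ≤ |x - t|) (n : ℕ) : MemLp (cauchyKer X (n + 1) t) 2 := by
  refine ⟨((measurable_cauchyKer hXm (n + 1)).comp
    measurable_prodMk_left).aestronglyMeasurable, ?_⟩
  rw [eLpNorm_lt_top_iff_lintegral_rpow_enorm_lt_top (by norm_num) (by norm_num)]
  have := (lintegral_enorm_cauchyKer_sq_le hXm hd hX n).trans_lt ENNReal.ofReal_lt_top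
  simpa using this

lemma integrable_cauchyKer_mul {X : Set ℝ} (hXm : MeasurableSet X) {d t : ℝ} (hd : 0 < d)
    (hX : ∀ x ∈ X, d ≤ |x - t|) (n : ℕ) {u : ℝ → ℂ} (hu : MemLp u 2) :
    Integrable fun x => cauchyKer X (n + 1) t x * u x :=
  (memLp_cauchyKer hXm hd hX n).integrable_mul hu

lemma hasDerivAt_cauchyTr {X : Set ℝ} (hXm : MeasurableSet X) {t : ℝ}
    (hX : ∀ x ∈ X, 1 ≤ |x - t|) (n : ℕ) {u : ℝ → ℂ} (hu : MemLp u 2) :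
    HasDerivAt (cauchyTr X (n + 1) u) ((n + 1) * cauchyTr X (n + 2) u t) t := by
  have hnear : ∀ s ∈ Metric.ball t (1 / 2), ∀ x ∈ X, |x - t| / 2 ≤ |x - s| := by
    intro s hs x hx
    rw [Metric.mem_ball, Real.dist_eq] at hs
    have h1 := hX x hx
    have h2 := abs_sub_abs_le_abs_sub (x - t) (s - t)
    rw [show x - t - (s - t) = x - s by ring] at h2
    linarith
  have hmeas : ∀ (s : ℝ) (m : ℕ), AEStronglyMeasurable (fun x => cauchyKer X m s x * u x) :=
    fun s m => ((measurable_cauchyKer hXm m).comp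
      measurable_prodMk_left).aestronglyMeasurable.mul hu.1
  have := (hasDerivAt_integral_of_dominated_loc_of_deriv_le (μ := volume)
    (F := fun s x => cauchyKer X (n + 1) s x * u x)
    (F' := fun s x => ((n : ℂ) + 1) * (cauchyKer X (n + 2) s x * u x)) (x₀ := t)
    (bound := fun x => ((n : ℝ) + 1) * 2 ^ (n + 2) * ‖cauchyKer X (n + 2) t x * u x‖)
    (Metric.ball_mem_nhds t (by norm_num : (0 : ℝ) < 1 / 2))
    (Eventually.of_forall fun s => hmeas s _)
    (integrable_cauchyKer_mul hXm one_pos hX n hu)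
    ((hmeas t _).const_mul _)
    (Eventually.of_forall fun x s hs => ?_)
    ((integrable_cauchyKer_mul hXm one_pos hX (n + 1) hu).norm.const_mul _)
    (Eventually.of_forall fun x s hs => ?_)).2
  · rwa [integral_const_mul] at this
  · by_cases hx : x ∈ X
    · have h1 := hnear s hs x hx
      have h2 := hX x hx
      have h3 : |x - s|⁻¹ ≤ 2 * |x - t|⁻¹ := by
        rw [show 2 * |x - t|⁻¹ = (|x - t| / 2)⁻¹ by rw [inv_div]; ring]
        exact inv_anti₀ (by linarith) h1
      have h4 : ‖(n : ℂ) + 1‖ = n + 1 := by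
        rw [show ((n : ℂ) + 1) = ((n + 1 : ℕ) : ℂ) by push_cast; rfl, Complex.norm_natCast]
        push_cast; rfl
      rw [norm_mul, norm_mul, norm_mul, h4, norm_cauchyKer_of_mem hx, norm_cauchyKer_of_mem hx,
        mul_assoc, ← mul_assoc (2 ^ (n + 2)), ← mul_pow]
      gcongr
    · simp [cauchyKer, hx]
  · by_cases hx : x ∈ X
    · have h1 := hnear s hs x hx
      have h2 := hX x hx
      have hne : (x : ℂ) - s ≠ 0 := by
        rw [← Complex.ofReal_sub, Complex.ofReal_ne_zero]
        exact abs_pos.1 (by linarith)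
      simp only [cauchyKer, Set.indicator_of_mem hx]
      have hd : HasDerivAt (fun s : ℝ => (x : ℂ) - s) (-1) s := by
        simpa using (Complex.ofRealCLM.hasDerivAt (x := s)).const_sub (x : ℂ)
      refine (((hd.fun_inv hne).fun_pow (n + 1)).mul_const (u x)).congr_deriv ?_
      simp only [Nat.add_sub_cancel]
      push_cast
      have h5 : -(-1 : ℂ) / ((x : ℂ) - s) ^ 2 = (((x : ℂ) - s)⁻¹) ^ 2 := by
        rw [neg_neg, one_div, inv_pow]
      rw [h5]
      ring
    · simpa [cauchyKer, hx] using hasDerivAt_const s (0 : ℂ)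

lemma measurable_cauchyTr {X : Set ℝ} (hXm : MeasurableSet X) (n : ℕ) (u : L2R) :
    Measurable (cauchyTr X n u) := by
  refine (StronglyMeasurable.integral_prod_right' (ν := volume)
    (f := fun z : ℝ × ℝ => cauchyKer X n z.1 z.2 * u z.2) ?_).measurable
  exact (measurable_cauchyKer hXm n).stronglyMeasurable.mul
    ((Lp.stronglyMeasurable u).comp_measurable measurable_snd)

/-- Bessel's inequality for functionals given by integration against a square-integrable
function. -/
lemma sum_enorm_integral_mul_sq_le {h : ℝ → ℂ} (hh : MemLp h 2) (S : Finset L2R)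
    (hS : Orthonormal ℂ (fun u : S => (u : L2R))) :
    ∑ u ∈ S, ‖∫ x, h x * u x‖ₑ ^ 2 ≤ ∫⁻ x, ‖h x‖ₑ ^ 2 := by
  have hc : MemLp (fun x => (starRingEnd ℂ) (h x)) 2 := hh.star
  set k : L2R := hc.toLp _ with hk
  have h1 : ∀ u : L2R, ∫ x, h x * u x = inner ℂ k u := fun u => by
    rw [L2.inner_def]
    refine integral_congr_ae ?_
    filter_upwards [hc.coeFn_toLp] with x hx
    rw [hk, hx]
    simp [mul_comm]
  have h2 := hS.sum_inner_products_le (s := Finset.univ) k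
  have h3 : ENNReal.ofReal (‖k‖ ^ 2) = ∫⁻ x, ‖h x‖ₑ ^ 2 := by
    rw [ENNReal.ofReal_pow (norm_nonneg _), ofReal_norm, hk, Lp.enorm_toLp,
      eLpNorm_eq_lintegral_rpow_enorm_toReal (by norm_num) (by norm_num), ← ENNReal.rpow_natCast,
      ← ENNReal.rpow_mul]
    simp
  rw [← h3]
  refine le_trans (le_of_eq ?_) (ENNReal.ofReal_le_ofReal h2)
  rw [ENNReal.ofReal_sum_of_nonneg (fun _ _ => by positivity), ← Finset.sum_coe_sort S]
  refine Finset.sum_congr rfl fun u _ => ?_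
  rw [ENNReal.ofReal_pow (norm_nonneg _), ofReal_norm, h1, ← ofReal_norm, norm_inner_symm,
    ofReal_norm]

end Cauchy

lemma ENNReal.mul_le_weighted_sq_add_sq (a b : ℝ≥0∞) {w : ℝ≥0∞} (hw0 : w ≠ 0) (hw : w ≠ ⊤) :
    a * b ≤ w * a ^ 2 + w⁻¹ * b ^ 2 := by
  rcases le_total b (w * a) with h | h
  · calc a * b ≤ a * (w * a) := by gcongr
      _ = w * a ^ 2 := by ring
      _ ≤ _ := le_self_add
  · have h' : a ≤ w⁻¹ * b := by
      rw [mul_comm, ← div_eq_mul_inv, ENNReal.le_div_iff_mul_le (Or.inl hw0) (Or.inl hw), mul_comm]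
      exact h
    calc a * b ≤ w⁻¹ * b * b := by gcongr
      _ = w⁻¹ * b ^ 2 := by ring
      _ ≤ _ := le_add_self

section Parts

/-- Integration by parts over a closed interval, with all boundary values controlled by the value
of `G` at one point of the interval and the total variation of `G`. -/
lemma enorm_setIntegral_deriv_mul_le {J : Set ℝ} (hJc : IsClosed J) (hJ : J.OrdConnected) {c : ℝ}
    (hc : c ∈ J) {F f G G' : ℝ → ℂ} {B : ℝ} (hF : ∀ t, HasDerivAt F (f t) t) (hf : Continuous f)
    (hFB : ∀ t, ‖F t‖ ≤ B) (hG : ∀ t ∈ J, HasDerivAt G (G' t) t) (hG' : ContinuousOn G' J)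
    (hint : IntegrableOn (fun t => f t * G t) J) :
    ‖∫ t in J, f t * G t‖ₑ ≤
      ENNReal.ofReal B * (2 * ‖G c‖ₑ + 3 * ∫⁻ t in J, ‖G' t‖ₑ) := by
  set V := ∫⁻ t in J, ‖G' t‖ₑ with hV
  have hFB' : ∀ t, ‖F t‖ₑ ≤ ENNReal.ofReal B := fun t => by
    rw [← ofReal_norm]; exact ENNReal.ofReal_le_ofReal (hFB t)
  have hGV : ∀ a ∈ J, ‖G a‖ₑ ≤ ‖G c‖ₑ + V := by
    intro a ha
    have hsub : uIcc c a ⊆ J := hJ.uIcc_subset hc ha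
    have h1 : ∫ t in c..a, G' t = G a - G c :=
      intervalIntegral.integral_eq_sub_of_hasDerivAt (fun t ht => hG t (hsub ht))
        (hG'.mono hsub).intervalIntegrable
    have h2 : ‖∫ t in c..a, G' t‖ₑ ≤ V := by
      rw [← ofReal_norm, intervalIntegral.norm_integral_eq_norm_integral_uIoc, ofReal_norm]
      exact (enorm_integral_le_lintegral_enorm _).trans
        (lintegral_mono_set (uIoc_subset_uIcc.trans hsub))
    calc ‖G a‖ₑ = ‖G c + ∫ t in c..a, G' t‖ₑ := by rw [h1]; ring_nf
      _ ≤ _ := (enorm_add_le _ _).trans (by gcongr)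
  have hfin : ∀ a ∈ J, ∀ b ∈ J, a ≤ b → ‖∫ t in Icc a b, f t * G t‖ₑ ≤
      ENNReal.ofReal B * (2 * ‖G c‖ₑ + 3 * V) := by
    intro a ha b hb hab
    have hsub : uIcc a b ⊆ J := hJ.uIcc_subset ha hb
    have hGc : ContinuousOn G (uIcc a b) := fun t ht =>
      (hG t (hsub ht)).continuousAt.continuousWithinAt
    have hparts := intervalIntegral.integral_deriv_mul_eq_sub (a := a) (b := b)
      (u := F) (v := G) (u' := f) (v' := G') (fun t _ => hF t) (fun t ht => hG t (hsub ht))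
      (hf.intervalIntegrable _ _) (hG'.mono hsub).intervalIntegrable
    have hFc : Continuous F := continuous_iff_continuousAt.2 fun t => (hF t).continuousAt
    have hint1 : IntervalIntegrable (fun t => f t * G t) volume a b :=
      (hf.continuousOn.mul hGc).intervalIntegrable
    have hint2 : IntervalIntegrable (fun t => F t * G' t) volume a b :=
      (hFc.continuousOn.mul (hG'.mono hsub)).intervalIntegrable
    rw [intervalIntegral.integral_add hint1 hint2] at hparts
    rw [integral_Icc_eq_integral_Ioc, ← intervalIntegral.integral_of_le hab,
      eq_sub_of_add_eq hparts]
    have h2 : ‖∫ t in a..b, F t * G' t‖ₑ ≤ ENNReal.ofReal B * V := by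
      rw [← ofReal_norm, intervalIntegral.norm_integral_eq_norm_integral_uIoc, ofReal_norm]
      refine (enorm_integral_le_lintegral_enorm _).trans ?_
      rw [hV, ← lintegral_const_mul' _ _ ENNReal.ofReal_ne_top]
      refine (lintegral_mono_set (uIoc_subset_uIcc.trans hsub)).trans (lintegral_mono fun t => ?_)
      rw [enorm_mul]
      gcongr
      exact hFB' t
    calc ‖F b * G b - F a * G a - ∫ t in a..b, F t * G' t‖ₑ
        ≤ ‖F b‖ₑ * ‖G b‖ₑ + ‖F a‖ₑ * ‖G a‖ₑ + ‖∫ t in a..b, F t * G' t‖ₑ := by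
          rw [← enorm_mul, ← enorm_mul]
          exact enorm_sub_le.trans (add_le_add_left enorm_sub_le _)
      _ ≤ ENNReal.ofReal B * (‖G c‖ₑ + V) + ENNReal.ofReal B * (‖G c‖ₑ + V) +
          ENNReal.ofReal B * V := by
          gcongr
          · exact hFB' b
          · exact hGV b hb
          · exact hFB' a
          · exact hGV a ha
      _ = _ := by ring
  have hcover : AECover (volume.restrict J) atTop (fun n : ℕ => Icc (-(n : ℝ)) n) :=
    aecover_Icc (tendsto_neg_atTop_atBot.comp tendsto_natCast_atTop_atTop)
      tendsto_natCast_atTop_atTop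
  have hlim := hcover.integral_tendsto_of_countably_generated hint
  refine le_of_tendsto hlim.enorm ?_
  obtain ⟨N, hN⟩ := exists_nat_ge |c|
  filter_upwards [eventually_ge_atTop N] with n hn
  have hcn : c ∈ Icc (-(n : ℝ)) n := by
    rw [mem_Icc, ← abs_le]
    exact hN.trans (by exact_mod_cast hn)
  rw [Measure.restrict_restrict measurableSet_Icc]
  set K := Icc (-(n : ℝ)) n ∩ J with hK
  have hKc : IsCompact K := isCompact_Icc.inter_right hJc
  have hKne : K.Nonempty := ⟨c, hcn, hc⟩
  have hKo : K.OrdConnected := ordConnected_Icc.inter hJ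
  have hKI := eq_Icc_of_connected_compact ⟨hKne, hKo.isPreconnected⟩ hKc
  rw [hKI]
  exact hfin _ (hKc.sInf_mem hKne).2 _ (hKc.sSup_mem hKne).2
    (csInf_le_csSup hKne hKc.bddBelow hKc.bddAbove)

end Parts

section Form

/-- `X` and `J` are separated by the point `p`, quantitatively as seen from `J`. -/
def SeparatedBy (X J : Set ℝ) (p : ℝ) : Prop :=
  ∀ t ∈ J, 1 ≤ |t - p| ∧ ∀ x ∈ X, |t - p| ≤ |x - t|

lemma SeparatedBy.one_le {X J : Set ℝ} {p t : ℝ} (h : SeparatedBy X J p) (ht : t ∈ J) :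
    ∀ x ∈ X, 1 ≤ |x - t| := fun x hx => (h t ht).1.trans ((h t ht).2 x hx)

/-- The quadratic functional controlling the operators `Y f Y*`. -/
def cauchyForm (X J : Set ℝ) (p c : ℝ) (u : ℝ → ℂ) : ℝ≥0∞ :=
  ‖cauchyTr X 1 u c‖ₑ ^ 2 + ∫⁻ t in J, (ENNReal.ofReal |t - p| * ‖cauchyTr X 2 u t‖ₑ ^ 2 +
    (ENNReal.ofReal |t - p|)⁻¹ * ‖cauchyTr X 1 u t‖ₑ ^ 2)

lemma sum_enorm_cauchyTr_sq_le {X : Set ℝ} (hXm : MeasurableSet X) {d t : ℝ} (hd : 0 < d)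
    (hX : ∀ x ∈ X, d ≤ |x - t|) (n : ℕ) (S : Finset L2R)
    (hS : Orthonormal ℂ (fun u : S => (u : L2R))) :
    ∑ u ∈ S, ‖cauchyTr X (n + 1) u t‖ₑ ^ 2 ≤ ENNReal.ofReal (2 * (d⁻¹) ^ (2 * n + 1)) :=
  (sum_enorm_integral_mul_sq_le (memLp_cauchyKer hXm hd hX n) S hS).trans
    (lintegral_enorm_cauchyKer_sq_le hXm hd hX n)

lemma sum_cauchyForm_le {X J : Set ℝ} (hXm : MeasurableSet X) (hJm : MeasurableSet J) {p c : ℝ}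
    (hsep : SeparatedBy X J p) (hc : c ∈ J) (S : Finset L2R)
    (hS : Orthonormal ℂ (fun u : S => (u : L2R))) :
    ∑ u ∈ S, cauchyForm X J p c u ≤ ENNReal.ofReal 10 := by
  have hmeas : ∀ (u : L2R) (n : ℕ), Measurable fun t => ‖cauchyTr X n u t‖ₑ ^ 2 :=
    fun u n => (measurable_cauchyTr hXm n u).enorm.pow_const 2
  have hw : Measurable fun t : ℝ => ENNReal.ofReal |t - p| := by fun_prop
  have hint : ∀ t ∈ J, ∑ u ∈ S, (ENNReal.ofReal |t - p| * ‖cauchyTr X 2 u t‖ₑ ^ 2 +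
      (ENNReal.ofReal |t - p|)⁻¹ * ‖cauchyTr X 1 u t‖ₑ ^ 2) ≤
      4 * ENNReal.ofReal ((|t - p|⁻¹) ^ 2) := by
    intro t ht
    have hd : 0 < |t - p| := one_pos.trans_le (hsep t ht).1
    have h1 := sum_enorm_cauchyTr_sq_le hXm hd (hsep t ht).2 0 S hS
    have h2 := sum_enorm_cauchyTr_sq_le hXm hd (hsep t ht).2 1 S hS
    rw [Finset.sum_add_distrib, ← Finset.mul_sum, ← Finset.mul_sum]
    refine (add_le_add (mul_le_mul_right h2 _) (mul_le_mul_right h1 _)).trans_eq ?_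
    rw [← ENNReal.ofReal_inv_of_pos hd, ← ENNReal.ofReal_mul hd.le,
      ← ENNReal.ofReal_mul (by positivity), ← ENNReal.ofReal_add (by positivity) (by positivity),
      show (4 : ℝ≥0∞) = ENNReal.ofReal 4 by simp, ← ENNReal.ofReal_mul (by norm_num)]
    congr 1
    generalize |t - p| = d at hd ⊢
    norm_num
    field_simp
    norm_num
  simp only [cauchyForm]
  have hsummand : ∀ u ∈ S, Measurable fun t =>
      (ENNReal.ofReal |t - p| * ‖cauchyTr X 2 u t‖ₑ ^ 2 +
        (ENNReal.ofReal |t - p|)⁻¹ * ‖cauchyTr X 1 u t‖ₑ ^ 2) :=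
    fun u _ => (hw.mul (hmeas u 2)).add (hw.inv.mul (hmeas u 1))
  rw [Finset.sum_add_distrib, ← lintegral_finsetSum _ hsummand]
  calc _ ≤ ENNReal.ofReal 2 + ∫⁻ t in J, 4 * ENNReal.ofReal ((|t - p|⁻¹) ^ 2) := by
        refine add_le_add ?_ (setLIntegral_mono' hJm hint)
        simpa using sum_enorm_cauchyTr_sq_le hXm one_pos (hsep.one_le hc) 0 S hS
    _ ≤ ENNReal.ofReal 2 + 4 * ENNReal.ofReal 2 := by
        rw [lintegral_const_mul' _ _ (by norm_num)]
        gcongr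
        simpa using lintegral_inv_sq_le one_pos fun t ht => (hsep t ht).1
    _ = ENNReal.ofReal 10 := by
        rw [show (4 : ℝ≥0∞) = ENNReal.ofReal 4 by simp, ← ENNReal.ofReal_mul (by norm_num),
          ← ENNReal.ofReal_add (by norm_num) (by norm_num)]
        norm_num

/-- The trace-norm bound for `Y (f - m) Y*` when `f - m` has a bounded primitive. -/
theorem traceNorm_comp_mul_comp_adjoint_le {X J : Set ℝ} (hXm : MeasurableSet X)
    (hJc : IsClosed J) (hJ : J.OrdConnected) {p c : ℝ} (hsep : SeparatedBy X J p) (hc : c ∈ J)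
    {s : ℂ} (hs : ‖s‖ ≤ 1) {Y M : L2R →L[ℂ] L2R}
    (hY : ∀ u : L2R, (ContinuousLinearMap.adjoint Y u : ℝ → ℂ) =ᵐ[volume]
      J.indicator fun t => s * cauchyTr X 1 u t)
    {f F : ℝ → ℂ} {m : ℂ} {B : ℝ} (hM : IsMul M f) (hf : Continuous f)
    (hF : ∀ t, HasDerivAt F (f t - m) t) (hFB : ∀ t, ‖F t‖ ≤ B) :
    traceNorm (Y ∘L M ∘L ContinuousLinearMap.adjoint Y -
      m • (Y ∘L ContinuousLinearMap.adjoint Y)) ≤ ENNReal.ofReal (240 * B) := by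
  have hB : 0 ≤ B := (norm_nonneg _).trans (hFB 0)
  have hder : ∀ (u : L2R), ∀ t ∈ J, HasDerivAt (cauchyTr X 1 u) (cauchyTr X 2 u t) t :=
    fun u t ht => by
      simpa using hasDerivAt_cauchyTr hXm (hsep.one_le ht) 0 (Lp.memLp u)
  have hder2 : ∀ (u : L2R), ∀ t ∈ J, ContinuousAt (cauchyTr X 2 u) t :=
    fun u t ht => (hasDerivAt_cauchyTr hXm (hsep.one_le ht) 1 (Lp.memLp u)).continuousAt
  have hmain := traceNorm_le_of_enorm_inner_le
    (Y ∘L M ∘L ContinuousLinearMap.adjoint Y - m • (Y ∘L ContinuousLinearMap.adjoint Y))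
    (fun u => ENNReal.ofReal (3 * B) * cauchyForm X J p c u)
    (ENNReal.ofReal (3 * B) * ENNReal.ofReal 10) (fun u v _ _ => ?_) (fun S hS => ?_)
  · refine hmain.trans_eq ?_
    rw [show (8 : ℝ≥0∞) = ENNReal.ofReal 8 by simp, ← ENNReal.ofReal_mul (by positivity),
      ← ENNReal.ofReal_mul (by positivity)]
    congr 1
    ring
  · set g : L2R → ℝ → ℂ := fun u t => s * cauchyTr X 1 u t with hg
    set g' : L2R → ℝ → ℂ := fun u t => s * cauchyTr X 2 u t with hg'
    have hgd : ∀ (u : L2R), ∀ t ∈ J, HasDerivAt (g u) (g' u t) t :=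
      fun u t ht => (hder u t ht).const_mul s
    have hinner : (fun t => inner ℂ (ContinuousLinearMap.adjoint Y v t)
        ((M (ContinuousLinearMap.adjoint Y u) - m • ContinuousLinearMap.adjoint Y u : L2R) t))
        =ᵐ[volume]
        J.indicator fun t => (f t - m) * ((starRingEnd ℂ) (g v t) * g u t) := by
      filter_upwards [hY u, hY v, hM (ContinuousLinearMap.adjoint Y u),
        Lp.coeFn_sub (M (ContinuousLinearMap.adjoint Y u)) (m • ContinuousLinearMap.adjoint Y u),
        Lp.coeFn_smul m (ContinuousLinearMap.adjoint Y u)] with t h1 h2 h3 h4 h5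
      rw [h4, Pi.sub_apply, h5, Pi.smul_apply, h3, h1, h2]
      by_cases ht : t ∈ J
      · simp only [Set.indicator_of_mem ht, RCLike.inner_apply, smul_eq_mul, hg]
        ring
      · simp [ht]
    have hint : IntegrableOn (fun t => (f t - m) * ((starRingEnd ℂ) (g v t) * g u t)) J := by
      rw [← integrable_indicator_iff hJc.measurableSet]
      exact (L2.integrable_inner _ _).congr hinner
    have hval : inner ℂ v ((Y ∘L M ∘L ContinuousLinearMap.adjoint Y -
        m • (Y ∘L ContinuousLinearMap.adjoint Y)) u) =
        ∫ t in J, (f t - m) * ((starRingEnd ℂ) (g v t) * g u t) := by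
      have : (Y ∘L M ∘L ContinuousLinearMap.adjoint Y -
          m • (Y ∘L ContinuousLinearMap.adjoint Y)) u =
          Y (M (ContinuousLinearMap.adjoint Y u) - m • ContinuousLinearMap.adjoint Y u) := by
        simp [map_sub]
      rw [this, ← ContinuousLinearMap.adjoint_inner_left, L2.inner_def, integral_congr_ae hinner,
        integral_indicator hJc.measurableSet]
    have hibp := enorm_setIntegral_deriv_mul_le hJc hJ hc hF (hf.sub continuous_const) hFB
      (G := fun t => (starRingEnd ℂ) (g v t) * g u t)
      (G' := fun t => (starRingEnd ℂ) (g' v t) * g u t + (starRingEnd ℂ) (g v t) * g' u t)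
      (fun t ht => ((hgd v t ht).star).mul (hgd u t ht))
      (fun t ht => by
        have h1 := fun u => (hgd u t ht).continuousAt
        have h2 : ∀ u, ContinuousAt (g' u) t := fun u => continuousAt_const.mul (hder2 u t ht)
        exact (((Complex.continuous_conj.continuousAt.comp (h2 v)).mul (h1 u)).add
          ((Complex.continuous_conj.continuousAt.comp (h1 v)).mul (h2 u))).continuousWithinAt)
      hint
    have hsn : ‖s‖ₑ ≤ 1 := by
      rw [← ofReal_norm, ← ENNReal.ofReal_one]
      exact ENNReal.ofReal_le_ofReal hs
    have hgn : ∀ (u : L2R) t, ‖g u t‖ₑ ≤ ‖cauchyTr X 1 u t‖ₑ := fun u t => by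
      rw [hg, enorm_mul]; exact mul_le_of_le_one_left' hsn
    have hgn' : ∀ (u : L2R) t, ‖g' u t‖ₑ ≤ ‖cauchyTr X 2 u t‖ₑ := fun u t => by
      rw [hg', enorm_mul]; exact mul_le_of_le_one_left' hsn
    have hconj : ∀ z : ℂ, ‖(starRingEnd ℂ) z‖ₑ = ‖z‖ₑ := fun z => by
      rw [← ofReal_norm, ← ofReal_norm, RCLike.norm_conj]
    rw [hval]
    refine hibp.trans ?_
    set I : L2R → ℝ≥0∞ := fun u =>
      ∫⁻ t in J, (ENNReal.ofReal |t - p| * ‖cauchyTr X 2 u t‖ₑ ^ 2 +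
        (ENNReal.ofReal |t - p|)⁻¹ * ‖cauchyTr X 1 u t‖ₑ ^ 2) with hI
    have hb1 : ‖(starRingEnd ℂ) (g v c) * g u c‖ₑ ≤
        ‖cauchyTr X 1 u c‖ₑ ^ 2 + ‖cauchyTr X 1 v c‖ₑ ^ 2 := by
      rw [enorm_mul, hconj, add_comm]
      refine (mul_le_mul' (hgn v c) (hgn u c)).trans ?_
      simpa using ENNReal.mul_le_weighted_sq_add_sq ‖cauchyTr X 1 v c‖ₑ ‖cauchyTr X 1 u c‖ₑ
        one_ne_zero ENNReal.one_ne_top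
    have hb2 : ∫⁻ t in J, ‖(starRingEnd ℂ) (g' v t) * g u t + (starRingEnd ℂ) (g v t) * g' u t‖ₑ ≤
        I u + I v := by
      have hm : ∀ (u : L2R) (n : ℕ), Measurable fun t => ‖cauchyTr X n u t‖ₑ ^ 2 :=
        fun u n => (measurable_cauchyTr hXm n u).enorm.pow_const 2
      have hw : Measurable fun t : ℝ => ENNReal.ofReal |t - p| := by fun_prop
      have hIm : Measurable fun t => (ENNReal.ofReal |t - p| * ‖cauchyTr X 2 u t‖ₑ ^ 2 +
          (ENNReal.ofReal |t - p|)⁻¹ * ‖cauchyTr X 1 u t‖ₑ ^ 2) :=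
        (hw.mul (hm u 2)).add (hw.inv.mul (hm u 1))
      refine le_trans ?_ (lintegral_add_left hIm _).le
      refine setLIntegral_mono' hJc.measurableSet fun t ht => ?_
      have hw0 : ENNReal.ofReal |t - p| ≠ 0 := by
        have := (hsep t ht).1
        simp only [ne_eq, ENNReal.ofReal_eq_zero, not_le]
        linarith
      refine (enorm_add_le _ _).trans ?_
      rw [enorm_mul (_ : ℂ) (g u t), enorm_mul (_ : ℂ) (g' u t), hconj, hconj]
      calc _ ≤ ‖cauchyTr X 2 v t‖ₑ * ‖cauchyTr X 1 u t‖ₑ +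
            ‖cauchyTr X 2 u t‖ₑ * ‖cauchyTr X 1 v t‖ₑ := by
            rw [mul_comm ‖g v t‖ₑ]
            gcongr
            exacts [hgn' v t, hgn u t, hgn' u t, hgn v t]
        _ ≤ _ := add_le_add
            (ENNReal.mul_le_weighted_sq_add_sq _ _ hw0 ENNReal.ofReal_ne_top)
            (ENNReal.mul_le_weighted_sq_add_sq _ _ hw0 ENNReal.ofReal_ne_top)
        _ = _ := by ring
    have hcf : ∀ u : L2R, cauchyForm X J p c u = ‖cauchyTr X 1 u c‖ₑ ^ 2 + I u := fun u => rfl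
    calc _ ≤ ENNReal.ofReal B * (3 * (‖cauchyTr X 1 u c‖ₑ ^ 2 + ‖cauchyTr X 1 v c‖ₑ ^ 2) +
          3 * (I u + I v)) := by
          gcongr
          norm_num
      _ = _ := by
          rw [hcf, hcf, ENNReal.ofReal_mul (by norm_num), show ENNReal.ofReal 3 = 3 by simp]
          ring
  · rw [← Finset.mul_sum]
    gcongr
    exact sum_cauchyForm_le hXm hJc.measurableSet hsep hc S hS

end Form

section Kernel

variable {A D : Set ℝ}

/-- The kernel `χ_A(x) χ_D(y) / (2π (x - y))`. -/
def cutoffKer (A D : Set ℝ) (x y : ℝ) : ℂ :=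
  A.indicator (fun _ => (1 : ℂ)) x * D.indicator (fun _ => (1 : ℂ)) y /
    (2 * Real.pi * ((x : ℂ) - (y : ℂ)))

lemma norm_inv_two_pi_le_one : ‖(2 * Real.pi : ℂ)⁻¹‖ ≤ 1 := by
  rw [norm_inv]
  refine inv_le_one_of_one_le₀ ?_
  rw [show (2 * Real.pi : ℂ) = ((2 * Real.pi : ℝ) : ℂ) by push_cast; rfl, Complex.norm_real,
    Real.norm_eq_abs]
  exact le_trans (by linarith [Real.pi_gt_three]) (le_abs_self _)

lemma cutoffKer_eq_left (x y : ℝ) :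
    cutoffKer A D x y = D.indicator (fun t => (2 * Real.pi : ℂ)⁻¹ * cauchyKer A 1 t x) y := by
  by_cases hx : x ∈ A <;> by_cases hy : y ∈ D <;>
    simp [cutoffKer, cauchyKer, hx, hy, div_eq_mul_inv]
  ring

lemma cutoffKer_eq_right (x y : ℝ) :
    cutoffKer A D x y = A.indicator (fun t => -(2 * Real.pi : ℂ)⁻¹ * cauchyKer D 1 t y) x := by
  by_cases hx : x ∈ A <;> by_cases hy : y ∈ D <;>
    simp [cutoffKer, cauchyKer, hx, hy, div_eq_mul_inv]
  rw [← neg_sub (y : ℂ) x, inv_neg]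
  ring

lemma HasKernel.ae_eq_indicator_cauchyTr {Z : L2R →L[ℂ] L2R} (hZ : HasKernel Z (cutoffKer A D))
    (u : L2R) :
    (Z u : ℝ → ℂ) =ᵐ[volume]
      A.indicator fun t => -(2 * Real.pi : ℂ)⁻¹ * cauchyTr D 1 u t := by
  filter_upwards [hZ u] with x hx
  rw [hx]
  simp only [cutoffKer_eq_right]
  by_cases h : x ∈ A
  · simp only [Set.indicator_of_mem h, cauchyTr, mul_assoc, integral_const_mul]
  · simp [h]

lemma integrable_indicator_cutoffKer_mul (hA : MeasurableSet A) (hD : MeasurableSet D)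
    (hsep : ∀ t ∈ D, ∀ x ∈ A, 1 ≤ |x - t|) {s : Set ℝ} (hs : MeasurableSet s)
    (hμs : volume s ≠ ⊤) (u : L2R) :
    Integrable (fun z : ℝ × ℝ => s.indicator (fun t => cutoffKer A D z.2 t * u z.2) z.1)
      (volume.prod volume) := by
  have hmeas : Measurable fun z : ℝ × ℝ =>
      s.indicator (fun t => cutoffKer A D z.2 t * u z.2) z.1 := by
    have : (fun z : ℝ × ℝ => s.indicator (fun t => cutoffKer A D z.2 t * u z.2) z.1) =
        (Prod.fst ⁻¹' s).indicator fun z => (Prod.fst ⁻¹' D).indicator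
          (fun z => (2 * Real.pi : ℂ)⁻¹ * cauchyKer A 1 z.1 z.2) z * u z.2 := by
      ext z
      simp only [cutoffKer_eq_left]
      rfl
    rw [this]
    refine Measurable.indicator (.mul ?_ ?_) (measurable_fst hs)
    · exact ((measurable_cauchyKer hA 1).const_mul _).indicator (measurable_fst hD)
    · exact (Lp.stronglyMeasurable u).measurable.comp measurable_snd
  refine ⟨hmeas.aestronglyMeasurable, ?_⟩
  have hpi : ‖(2 * Real.pi : ℂ)⁻¹‖ₑ ≤ 1 := by
    rw [← ofReal_norm, ← ENNReal.ofReal_one]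
    exact ENNReal.ofReal_le_ofReal norm_inv_two_pi_le_one
  set C : ℝ≥0∞ := ENNReal.ofReal 2 + ∫⁻ x, ‖u x‖ₑ ^ 2 with hC
  have hCtop : C ≠ ⊤ := by
    refine ENNReal.add_ne_top.2 ⟨ENNReal.ofReal_ne_top, ?_⟩
    have := (eLpNorm_lt_top_iff_lintegral_rpow_enorm_lt_top (by norm_num) (by norm_num)).1
      (Lp.memLp u).2
    simpa using this.ne
  rw [hasFiniteIntegral_iff_enorm, lintegral_prod _ hmeas.enorm.aemeasurable]
  calc _ ≤ ∫⁻ t, s.indicator (fun _ => C) t := lintegral_mono fun t => ?_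
    _ = C * volume s := lintegral_indicator_const hs C
    _ < ⊤ := ENNReal.mul_lt_top hCtop.lt_top hμs.lt_top
  by_cases hts : t ∈ s
  · simp only [Set.indicator_of_mem hts, cutoffKer_eq_left]
    by_cases htD : t ∈ D
    · simp only [Set.indicator_of_mem htD]
      calc _ ≤ ∫⁻ x, (‖cauchyKer A 1 t x‖ₑ ^ 2 + ‖u x‖ₑ ^ 2) := lintegral_mono fun x => ?_
        _ = (∫⁻ x, ‖cauchyKer A 1 t x‖ₑ ^ 2) + ∫⁻ x, ‖u x‖ₑ ^ 2 :=
          lintegral_add_right _ ((Lp.stronglyMeasurable u).measurable.enorm.pow_const 2)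
        _ ≤ C := add_le_add
          (by simpa using lintegral_enorm_cauchyKer_sq_le hA one_pos (hsep t htD) 0) le_rfl
      rw [enorm_mul, enorm_mul]
      calc _ ≤ ‖cauchyKer A 1 t x‖ₑ * ‖u x‖ₑ := by
            gcongr
            exact mul_le_of_le_one_left' hpi
        _ ≤ _ := by
          simpa using ENNReal.mul_le_weighted_sq_add_sq ‖cauchyKer A 1 t x‖ₑ ‖u x‖ₑ
            one_ne_zero ENNReal.one_ne_top
    · simp [htD]
  · simp [hts]

lemma HasKernel.adjoint_ae_eq_indicator_cauchyTr (hA : MeasurableSet A) (hD : MeasurableSet D)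
    (hsep : ∀ t ∈ D, ∀ x ∈ A, 1 ≤ |x - t|) {Z : L2R →L[ℂ] L2R}
    (hZ : HasKernel Z (cutoffKer A D)) (u : L2R) :
    (ContinuousLinearMap.adjoint Z u : ℝ → ℂ) =ᵐ[volume]
      D.indicator fun t => (2 * Real.pi : ℂ)⁻¹ * cauchyTr A 1 u t := by
  have hinner : ∀ t, ∫ x, cutoffKer A D x t * u x =
      D.indicator (fun t => (2 * Real.pi : ℂ)⁻¹ * cauchyTr A 1 u t) t := fun t => by
    simp only [cutoffKer_eq_left]
    by_cases h : t ∈ D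
    · simp only [Set.indicator_of_mem h, cauchyTr, mul_assoc, integral_const_mul]
    · simp [h]
  have hslice : ∀ (s : Set ℝ) t, ∫ x, s.indicator (fun t => cutoffKer A D x t * u x) t =
      s.indicator (D.indicator fun t => (2 * Real.pi : ℂ)⁻¹ * cauchyTr A 1 u t) t := fun s t => by
    by_cases h : t ∈ s
    · simp only [Set.indicator_of_mem h, hinner]
    · simp [h]
  refine ae_eq_of_forall_setIntegral_eq_of_sigmaFinite
    (fun s _ hs => integrableOn_Lp_of_measure_ne_top _ one_le_two hs.ne) (fun s hsm hs => ?_)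
    (fun s hsm hs => ?_)
  · have := (integrable_indicator_cutoffKer_mul hA hD hsep hsm hs.ne u).integral_prod_left
    simp only [hslice] at this
    exact (integrable_indicator_iff hsm).1 this
  · have hI := integrable_indicator_cutoffKer_mul hA hD hsep hsm hs.ne u
    rw [← integral_indicator hsm (f := D.indicator _)]
    simp only [← hslice]
    rw [integral_integral_swap hI, ← L2.inner_indicatorConstLp_one (𝕜 := ℂ) hsm hs.ne,
      ContinuousLinearMap.adjoint_inner_right, L2.inner_def]
    refine integral_congr_ae ?_
    filter_upwards [hZ (indicatorConstLp 2 hsm hs.ne (1 : ℂ))] with x hx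
    rw [hx, RCLike.inner_apply, ← integral_conj, ← integral_const_mul]
    refine integral_congr_ae ?_
    filter_upwards [indicatorConstLp_coeFn (μ := volume) (p := 2) (hs := hsm) (hμs := hs.ne)
      (c := (1 : ℂ))] with t ht
    rw [ht]
    have hreal : (starRingEnd ℂ) (cutoffKer A D x t) = cutoffKer A D x t := by
      by_cases hx : x ∈ A <;> by_cases hy : t ∈ D <;> simp [cutoffKer, hx, hy, Complex.conj_ofNat]
    by_cases h : t ∈ s
    · simp [h, hreal, mul_comm]
    · simp [h]

end Kernel

section Primitive

/-- A trigonometric series with absolutely summable coefficients whose nonzero frequencies are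
bounded away from zero has, after subtraction of a constant, a bounded primitive. -/
lemma exists_bounded_primitive {ι : Type*} {a : ι → ℂ} (ha : Summable fun i => ‖a i‖) (ω : ι → ℝ)
    {ε : ℝ} (hε : 0 < ε) (hω : ∀ i, ω i = 0 ∨ ε ≤ |ω i|) {f : ℝ → ℂ}
    (hf : ∀ x : ℝ, f x = ∑' i, a i * cexp (I * ω i * x)) :
    ∃ (m : ℂ) (F : ℝ → ℂ) (B : ℝ), Continuous f ∧ (∀ t, HasDerivAt F (f t - m) t) ∧
      ∀ t, ‖F t‖ ≤ B := by
  have hexp : ∀ i (x : ℝ), ‖cexp (I * ω i * x)‖ = 1 := fun i x => by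
    rw [show I * ω i * x = ((ω i * x : ℝ) : ℂ) * I by push_cast; ring, norm_exp_ofReal_mul_I]
  have hcoef : ∀ i, ‖a i / (I * ω i)‖ ≤ ‖a i‖ * ε⁻¹ := fun i => by
    rcases hω i with h | h
    · rw [h]
      simp only [ofReal_zero, mul_zero, div_zero, norm_zero]
      positivity
    · rw [norm_div, norm_mul, Complex.norm_I, one_mul, Complex.norm_real, Real.norm_eq_abs,
        div_eq_mul_inv]
      gcongr
  have hb : ∀ i, ‖a i / (I * ω i) * (I * ω i)‖ ≤ ‖a i‖ := fun i => by
    by_cases h : I * (ω i : ℂ) = 0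
    · simp [h]
    · rw [div_mul_cancel₀ _ h]
  have hbsum : Summable fun i => a i / (I * ω i) * (I * ω i) :=
    Summable.of_norm_bounded ha hb
  have hFb : ∀ (x : ℝ) i, ‖a i / (I * ω i) * cexp (I * ω i * x)‖ ≤ ‖a i‖ * ε⁻¹ := fun x i => by
    rw [norm_mul, hexp, mul_one]
    exact hcoef i
  have hbsum' : ∀ x : ℝ, Summable fun i => a i / (I * ω i) * (I * ω i) * cexp (I * ω i * x) :=
    fun x => Summable.of_norm_bounded ha fun i => by
      rw [norm_mul, hexp, mul_one]
      exact hb i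
  have hasum : ∀ x : ℝ, Summable fun i => a i * cexp (I * ω i * x) :=
    fun x => Summable.of_norm_bounded ha fun i => by rw [norm_mul, hexp, mul_one]
  refine ⟨∑' i, (a i - a i / (I * ω i) * (I * ω i)),
    fun t => ∑' i, a i / (I * ω i) * cexp (I * ω i * t), ∑' i, ‖a i‖ * ε⁻¹, ?_, fun t => ?_,
    fun t => ?_⟩
  · rw [funext hf]
    exact continuous_tsum (fun i => by fun_prop) ha fun i x => by rw [norm_mul, hexp, mul_one]
  · have hd := hasDerivAt_tsum (𝕜 := ℝ) (y₀ := (0 : ℝ))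
      (g := fun i (t : ℝ) => a i / (I * ω i) * cexp (I * ω i * t))
      (g' := fun i t => a i / (I * ω i) * (I * ω i) * cexp (I * ω i * t)) ha
      (fun i y => ?_) (fun i y => ?_)
      (Summable.of_norm_bounded (ha.mul_right ε⁻¹) (hFb 0)) t
    · refine hd.congr_deriv ?_
      rw [hf, ← (hasum t).tsum_sub (ha.of_norm.sub hbsum)]
      refine tsum_congr fun i => ?_
      by_cases h : I * (ω i : ℂ) = 0
      · simp [h]
      · rw [div_mul_cancel₀ _ h]
        ring
    · have h1 : HasDerivAt (fun t : ℝ => I * ω i * t) (I * ω i) y := by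
        simpa using (Complex.ofRealCLM.hasDerivAt (x := y)).const_mul (I * (ω i : ℂ))
      refine (h1.cexp.const_mul _).congr_deriv ?_
      ring
    · rw [norm_mul, hexp, mul_one]
      exact hb i
  · exact tsum_of_norm_bounded (ha.mul_right ε⁻¹).hasSum (hFb t)

lemma APmean.eq_of_hasDerivAt {f F : ℝ → ℂ} {m c : ℂ} {B : ℝ} (hf : Continuous f)
    (hF : ∀ t, HasDerivAt F (f t - m) t) (hFB : ∀ t, ‖F t‖ ≤ B) (hc : APmean f c) : m = c := by
  have hval : ∀ T : ℝ, 0 < T →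
      (2 * T)⁻¹ • ∫ t in (-T)..T, f t = m + (2 * T)⁻¹ • (F T - F (-T)) := fun T hT => by
    have h1 : ∫ t in (-T)..T, (f t - m) = F T - F (-T) :=
      intervalIntegral.integral_eq_sub_of_hasDerivAt (fun t _ => hF t)
        ((hf.sub continuous_const).intervalIntegrable _ _)
    rw [intervalIntegral.integral_sub (hf.intervalIntegrable _ _)
      (continuous_const.intervalIntegrable _ _), intervalIntegral.integral_const,
      sub_eq_iff_eq_add] at h1
    rw [h1, smul_add, smul_smul, show T - -T = 2 * T by ring, inv_mul_cancel₀ (by positivity),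
      one_smul, add_comm]
  have hzero : Tendsto (fun T : ℝ => (2 * T)⁻¹ • (F T - F (-T))) atTop (𝓝 0) := by
    have hinv : Tendsto (fun T : ℝ => (2 * T)⁻¹) atTop (𝓝 0) :=
      tendsto_inv_atTop_zero.comp (tendsto_id.const_mul_atTop two_pos)
    refine hinv.zero_smul_isBoundedUnder_le ?_
    refine isBoundedUnder_of ⟨B + B, fun T => ?_⟩
    exact (norm_sub_le _ _).trans (add_le_add (hFB _) (hFB _))
  refine tendsto_nhds_unique ?_ hc
  have := (tendsto_const_nhds (x := m)).add hzero
  rw [add_zero] at this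
  refine this.congr' ?_
  filter_upwards [eventually_gt_atTop 0] with T hT
  exact (hval T hT).symm

lemma exists_pos_forall_add_intCast (β : ℝ) :
    ∃ ε > 0, ∀ k : ℤ, β + k = 0 ∨ ε ≤ |β + k| := by
  by_cases h : Int.fract β = 0
  · refine ⟨1, one_pos, fun k => ?_⟩
    have hβ : β = (⌊β⌋ : ℝ) := by rw [Int.fract] at h; linarith
    rw [hβ, ← Int.cast_add]
    rcases eq_or_ne (⌊β⌋ + k) 0 with h0 | h0
    · left; rw [h0, Int.cast_zero]
    · right; rw [← Int.cast_abs]; exact_mod_cast Int.one_le_abs h0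
  · have h0 : 0 < Int.fract β := lt_of_le_of_ne (Int.fract_nonneg β) (Ne.symm h)
    have h1 := Int.fract_lt_one β
    refine ⟨min (Int.fract β) (1 - Int.fract β), lt_min h0 (by linarith), fun k => Or.inr ?_⟩
    have hβ : β + k = Int.fract β + ((⌊β⌋ + k : ℤ) : ℝ) := by
      push_cast
      rw [Int.fract]; ring
    rw [hβ]
    rcases le_or_gt 0 (⌊β⌋ + k) with hk | hk
    · have hk' : (0 : ℝ) ≤ ((⌊β⌋ + k : ℤ) : ℝ) := by exact_mod_cast hk
      exact (min_le_left _ _).trans ((by linarith : Int.fract β ≤ _).trans (le_abs_self _))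
    · have hk' : ((⌊β⌋ + k : ℤ) : ℝ) ≤ -1 := by exact_mod_cast Int.le_sub_one_of_lt hk
      exact (min_le_right _ _).trans ((by linarith : 1 - Int.fract β ≤ _).trans (neg_le_abs _))

end Primitive

section Bloch

variable {c : ℤ → ℂ} {δ : ℝ} {Φ : ℝ → ℂ}

lemma summable_norm_mul_cexp (hc : Summable fun m => ‖c m‖) (x : ℝ) :
    Summable fun m : ℤ => ‖c m * cexp (I * ((δ : ℂ) + (m : ℂ)) * x)‖ := by
  refine hc.congr fun m => ?_
  rw [norm_mul, show I * ((δ : ℂ) + (m : ℂ)) * x = (((δ + m) * x : ℝ) : ℂ) * I by push_cast; ring,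
    norm_exp_ofReal_mul_I, mul_one]

lemma exists_bounded_primitive_mul_self (hc : Summable fun m => ‖c m‖)
    (hΦ : ∀ x : ℝ, Φ x = ∑' m : ℤ, c m * cexp (I * ((δ : ℂ) + (m : ℂ)) * x)) :
    ∃ (m : ℂ) (F : ℝ → ℂ) (B : ℝ), Continuous (fun x => Φ x * Φ x) ∧
      (∀ t, HasDerivAt F (Φ t * Φ t - m) t) ∧ ∀ t, ‖F t‖ ≤ B := by
  obtain ⟨ε, hε, hgap⟩ := exists_pos_forall_add_intCast (2 * δ)
  refine exists_bounded_primitive (a := fun i : ℤ × ℤ => c i.1 * c i.2)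
    (hc.mul_norm hc) (fun i => 2 * δ + ((i.1 + i.2 : ℤ) : ℝ)) hε (fun i => hgap _) fun x => ?_
  rw [hΦ, tsum_mul_tsum_of_summable_norm (summable_norm_mul_cexp hc x)
    (summable_norm_mul_cexp hc x)]
  refine tsum_congr fun i => ?_
  rw [mul_mul_mul_comm, ← Complex.exp_add]
  congr 2
  push_cast
  ring

lemma exists_bounded_primitive_mul_conj (hc : Summable fun m => ‖c m‖)
    (hΦ : ∀ x : ℝ, Φ x = ∑' m : ℤ, c m * cexp (I * ((δ : ℂ) + (m : ℂ)) * x)) :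
    ∃ (m : ℂ) (F : ℝ → ℂ) (B : ℝ), Continuous (fun x => Φ x * (starRingEnd ℂ) (Φ x)) ∧
      (∀ t, HasDerivAt F (Φ t * (starRingEnd ℂ) (Φ t) - m) t) ∧ ∀ t, ‖F t‖ ≤ B := by
  have hgap : ∀ k : ℤ, (k : ℝ) = 0 ∨ 1 ≤ |(k : ℝ)| := fun k => by
    rcases eq_or_ne k 0 with h | h
    · exact Or.inl (by rw [h, Int.cast_zero])
    · exact Or.inr (by exact_mod_cast Int.one_le_abs h)
  have hc' : Summable fun m => ‖(starRingEnd ℂ) (c m)‖ :=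
    hc.congr fun m => (RCLike.norm_conj (c m)).symm
  have ha : Summable fun i : ℤ × ℤ => ‖c i.1 * (starRingEnd ℂ) (c i.2)‖ :=
    Summable.mul_norm (f := c) (g := fun m => (starRingEnd ℂ) (c m)) hc hc'
  refine exists_bounded_primitive ha (fun i => ((i.1 - i.2 : ℤ) : ℝ)) one_pos
    (fun i => hgap (i.1 - i.2)) fun x => ?_
  have hs := summable_norm_mul_cexp (δ := δ) hc x
  have hs' : Summable fun m : ℤ =>
      ‖(starRingEnd ℂ) (c m * cexp (I * ((δ : ℂ) + (m : ℂ)) * x))‖ :=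
    hs.congr fun m => (RCLike.norm_conj _).symm
  rw [hΦ, Complex.conj_tsum, tsum_mul_tsum_of_summable_norm hs hs']
  refine tsum_congr fun i => ?_
  rw [map_mul, mul_mul_mul_comm, ← Complex.exp_conj, ← Complex.exp_add]
  have harg : I * ((δ : ℂ) + (i.1 : ℂ)) * x + (starRingEnd ℂ) (I * ((δ : ℂ) + (i.2 : ℂ)) * x) =
      I * (((i.1 - i.2 : ℤ) : ℝ) : ℂ) * x := by
    simp only [map_mul, map_add, Complex.conj_I, Complex.conj_ofReal, map_intCast]
    push_cast
    ring
  rw [harg]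

end Bloch

/-- The adjoint of each `Y_α^±` is a truncated Cauchy transform onto a closed interval separated
from the support of its kernel. -/
lemma exists_adjoint_ae_eq_cauchyTr {Zp Zm : ℝ → (L2R →L[ℂ] L2R)}
    (hZp : ∀ α : ℝ, HasKernel (Zp α) (ZplusKer α))
    (hZm : ∀ α : ℝ, HasKernel (Zm α) (ZminusKer α)) {Y : ℝ → (L2R →L[ℂ] L2R)}
    (hY : (∀ α, Y α = Zp α) ∨ (∀ α, Y α = ContinuousLinearMap.adjoint (Zp α)) ∨
      (∀ α, Y α = Zm α) ∨ (∀ α, Y α = ContinuousLinearMap.adjoint (Zm α))) {α : ℝ}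
    (hα : 1 ≤ α) :
    ∃ (X J : Set ℝ) (p c : ℝ) (s : ℂ), MeasurableSet X ∧ IsClosed J ∧ J.OrdConnected ∧
      SeparatedBy X J p ∧ c ∈ J ∧ ‖s‖ ≤ 1 ∧
      ∀ u : L2R, (ContinuousLinearMap.adjoint (Y α) u : ℝ → ℂ) =ᵐ[volume]
        J.indicator fun t => s * cauchyTr X 1 u t := by
  have hs : ‖(2 * Real.pi : ℂ)⁻¹‖ ≤ 1 := norm_inv_two_pi_le_one
  have hs' : ‖-(2 * Real.pi : ℂ)⁻¹‖ ≤ 1 := by rwa [norm_neg]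
  have hZp' : HasKernel (Zp α) (cutoffKer (Ioi (α + 1)) (Ioo (-α) α)) := hZp α
  have hZm' : HasKernel (Zm α) (cutoffKer (Iio (-α - 1)) (Ioo (-α) α)) := hZm α
  have hsep1 : SeparatedBy (Ioi (α + 1)) (Icc (-α) α) (α + 1) := by
    intro t ht
    rw [mem_Icc] at ht
    refine ⟨?_, fun x hx => ?_⟩
    · rw [abs_of_neg] <;> linarith
    · rw [mem_Ioi] at hx
      rw [abs_of_neg (by linarith), abs_of_pos (by linarith)]
      linarith
  have hsep2 : SeparatedBy (Ioo (-α) α) (Ici (α + 1)) α := by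
    intro t ht
    rw [mem_Ici] at ht
    refine ⟨?_, fun x hx => ?_⟩
    · rw [abs_of_pos] <;> linarith
    · rw [mem_Ioo] at hx
      rw [abs_of_pos (by linarith), abs_of_neg (by linarith)]
      linarith
  have hsep3 : SeparatedBy (Iio (-α - 1)) (Icc (-α) α) (-α - 1) := by
    intro t ht
    rw [mem_Icc] at ht
    refine ⟨?_, fun x hx => ?_⟩
    · rw [abs_of_pos] <;> linarith
    · rw [mem_Iio] at hx
      rw [abs_of_pos (by linarith), abs_of_neg (by linarith)]
      linarith
  have hsep4 : SeparatedBy (Ioo (-α) α) (Iic (-α - 1)) (-α) := by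
    intro t ht
    rw [mem_Iic] at ht
    refine ⟨?_, fun x hx => ?_⟩
    · rw [abs_of_neg] <;> linarith
    · rw [mem_Ioo] at hx
      rw [abs_of_neg (by linarith), abs_of_pos (by linarith)]
      linarith
  have h0 : (0 : ℝ) ∈ Icc (-α) α := by rw [mem_Icc]; constructor <;> linarith
  rcases hY with hY | hY | hY | hY <;> rw [hY α]
  · refine ⟨_, _, _, 0, _, measurableSet_Ioi, isClosed_Icc, ordConnected_Icc, hsep1, h0, hs,
      fun u => ?_⟩
    exact (hZp'.adjoint_ae_eq_indicator_cauchyTr measurableSet_Ioi measurableSet_Ioo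
      (fun t ht => hsep1.one_le (Ioo_subset_Icc_self ht)) u).trans
        (indicator_ae_eq_of_ae_eq_set Ioo_ae_eq_Icc)
  · refine ⟨_, _, _, α + 1, _, measurableSet_Ioo, isClosed_Ici, ordConnected_Ici, hsep2,
      self_mem_Ici, hs', fun u => ?_⟩
    rw [ContinuousLinearMap.adjoint_adjoint]
    exact (hZp'.ae_eq_indicator_cauchyTr u).trans (indicator_ae_eq_of_ae_eq_set Ioi_ae_eq_Ici)
  · refine ⟨_, _, _, 0, _, measurableSet_Iio, isClosed_Icc, ordConnected_Icc, hsep3, h0, hs,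
      fun u => ?_⟩
    exact (hZm'.adjoint_ae_eq_indicator_cauchyTr measurableSet_Iio measurableSet_Ioo
      (fun t ht => hsep3.one_le (Ioo_subset_Icc_self ht)) u).trans
        (indicator_ae_eq_of_ae_eq_set Ioo_ae_eq_Icc)
  · refine ⟨_, _, _, -α - 1, _, measurableSet_Ioo, isClosed_Iic, ordConnected_Iic, hsep4,
      self_mem_Iic, hs', fun u => ?_⟩
    rw [ContinuousLinearMap.adjoint_adjoint]
    exact (hZm'.ae_eq_indicator_cauchyTr u).trans (indicator_ae_eq_of_ae_eq_set Iio_ae_eq_Iic)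

/-- averaging out the Bloch eigenfunction. For the Bloch function
`Φ = Φ(⬝,δ)` of a genuine spectral band at Fermi quasimomentum `δ` (a continuous
almost-periodic function `Φ(x) = Σ_m c_m e^{i(δ+m)x}` with `Σ_m |c_m|(1+|m|) < ∞`,
`ℳ(|Φ|²) = 1/(2π)` and `ℳ(Φ²) = 0`), and `Y_α^±` any of the operators `Z_α^±` or
`(Z_α^±)^*`, one has
`Y_α^± |Φ|² (Y_α^±)^* ∼ (2π)⁻¹ Y_α^± (Y_α^±)^*` and `Y_α^± Φ² (Y_α^±)^* ∼ 0`,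
i.e. the trace norms of the differences are bounded uniformly in `α ≥ 1`. -/
theorem statement16
    (δ : ℝ) (c : ℤ → ℂ)
    (hsum : Summable fun m : ℤ => ‖c m‖ * (1 + |(m : ℝ)|))
    (Φ : ℝ → ℂ)
    (hΦ : ∀ x : ℝ, Φ x = ∑' m : ℤ, c m * Complex.exp (Complex.I * ((δ : ℂ) + (m : ℂ)) * x))
    (hm1 : APmean (fun x => Φ x * (starRingEnd ℂ) (Φ x)) (((2 * Real.pi)⁻¹ : ℝ) : ℂ))
    (hm2 : APmean (fun x => Φ x * Φ x) 0)
    -- multiplication by |Φ|² and by Φ²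
    (M1 M2 : L2R →L[ℂ] L2R)
    (hM1 : IsMul M1 (fun x => Φ x * (starRingEnd ℂ) (Φ x)))
    (hM2 : IsMul M2 (fun x => Φ x * Φ x))
    -- the operators Z_α^±
    (Zp Zm : ℝ → (L2R →L[ℂ] L2R))
    (hZp : ∀ α : ℝ, HasKernel (Zp α) (ZplusKer α))
    (hZm : ∀ α : ℝ, HasKernel (Zm α) (ZminusKer α)) :
    ∀ Y : ℝ → (L2R →L[ℂ] L2R),
      ((∀ α, Y α = Zp α) ∨ (∀ α, Y α = ContinuousLinearMap.adjoint (Zp α)) ∨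
       (∀ α, Y α = Zm α) ∨ (∀ α, Y α = ContinuousLinearMap.adjoint (Zm α))) →
      ∃ C : ℝ, ∀ α : ℝ, 1 ≤ α →
        traceNorm (Y α ∘L M1 ∘L ContinuousLinearMap.adjoint (Y α) -
          (((2 * Real.pi)⁻¹ : ℝ) : ℂ) • (Y α ∘L ContinuousLinearMap.adjoint (Y α)))
          ≤ ENNReal.ofReal C ∧
        traceNorm (Y α ∘L M2 ∘L ContinuousLinearMap.adjoint (Y α)) ≤ ENNReal.ofReal C := by
  have hc : Summable fun m => ‖c m‖ := hsum.of_nonneg_of_le (fun m => norm_nonneg _) fun m =>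
    le_mul_of_one_le_right (norm_nonneg _) (by linarith [abs_nonneg (m : ℝ)])
  obtain ⟨m₁, F₁, B₁, hf₁, hF₁, hB₁⟩ := exists_bounded_primitive_mul_conj hc hΦ
  obtain ⟨m₂, F₂, B₂, hf₂, hF₂, hB₂⟩ := exists_bounded_primitive_mul_self hc hΦ
  obtain rfl := hm1.eq_of_hasDerivAt hf₁ hF₁ hB₁
  obtain rfl := hm2.eq_of_hasDerivAt hf₂ hF₂ hB₂
  intro Y hY
  refine ⟨max (240 * B₁) (240 * B₂), fun α hα => ?_⟩
  obtain ⟨X, J, p, c₀, s, hX, hJc, hJ, hsep, hc₀, hs, hadj⟩ :=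
    exists_adjoint_ae_eq_cauchyTr hZp hZm hY hα
  constructor
  · exact (traceNorm_comp_mul_comp_adjoint_le hX hJc hJ hsep hc₀ hs hadj hM1 hf₁ hF₁ hB₁).trans
      (ENNReal.ofReal_le_ofReal (le_max_left _ _))
  · have := traceNorm_comp_mul_comp_adjoint_le hX hJc hJ hsep hc₀ hs hadj hM2 hf₂ hF₂ hB₂
    rw [zero_smul, sub_zero] at this
    exact this.trans (ENNReal.ofReal_le_ofReal (le_max_right _ _))

end
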